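/- Let N ≥ 1, 0 < γ < min{2,N}, 1 < p < p_F := 1 + 2/N, 0 < T < ∞ and z ∈ ℝ^N \ {0}. Set ψ(z) := |z|^{2/(p−1)} (1+|z|)^{−(2−γ)/(p−1)}. There exist constants c* > 0 and C* > 0 depending only on N, p, γ (and not on T or z) with the following property: if u₀ is the nonnegative Radon measure u₀ = c ψ(z) δ_z + φ dx, where δ_z is the Dirac measure concentrated at z and φ ∈ L^∞(ℝ^N) is nonnegative with ‖φ‖_{L^∞} ≤ C₀, and if 0 < c ≤ c* T^{−N(p_F−p)/(2(p−1))} (1 + T^{1−γ/2})^{−1/(p−1)} and 0 ≤ C₀ ≤ C* T^{−(2−γ)/(2(p−1))}, then the Hardy parabolic equation ∂_t u − Δu = |x|^{−γ} u^p with initial data u₀ possesses a solution on ℝ^N × [0,T). -/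

import Mathlib

open MeasureTheory Real Set

noncomputable def heatKernel (N : ℕ) (x : EuclideanSpace ℝ (Fin N)) (t : ℝ) : ℝ :=
  (4 * Real.pi * t) ^ (-(N : ℝ) / 2) * Real.exp (-‖x‖ ^ 2 / (4 * t))

/-- `u` is a (nonnegative, integral) solution of `∂_t u - Δu = |x|^{-γ} u^p`
with initial data the nonnegative Radon measure `μ`, on `ℝ^N × [0,T)`. -/
def IsSolMeas (N : ℕ) (γ p T : ℝ) (μ : Measure (EuclideanSpace ℝ (Fin N)))
    (u : EuclideanSpace ℝ (Fin N) → ℝ → ℝ) : Prop :=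
  Measurable (Function.uncurry u) ∧ (∀ x t, 0 ≤ u x t) ∧
    ∀ᵐ q : EuclideanSpace ℝ (Fin N) × ℝ,
      q.2 ∈ Set.Ioo 0 T →
        u q.1 q.2 = (∫ y, heatKernel N (q.1 - y) q.2 ∂μ) +
          ∫ s in Set.Ioo 0 q.2, ∫ y,
            heatKernel N (q.1 - y) (q.2 - s) * ‖y‖ ^ (-γ) * u y s ^ p

open scoped ENNReal

section HeatKernel

variable {N : ℕ}

lemma heatKernel_nonneg (x : EuclideanSpace ℝ (Fin N)) {t : ℝ} (ht : 0 < t) :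
    0 ≤ heatKernel N x t := by
  unfold heatKernel; positivity

@[fun_prop]
lemma Measurable.heatKernel {α : Type*} [MeasurableSpace α] {f : α → EuclideanSpace ℝ (Fin N)}
    {g : α → ℝ} (hf : Measurable f) (hg : Measurable g) :
    Measurable fun a => heatKernel N (f a) (g a) := by
  unfold _root_.heatKernel; fun_prop

lemma lintegral_rexp_neg_mul_sq_norm {b : ℝ} (hb : 0 < b) :
    ∫⁻ v : EuclideanSpace ℝ (Fin N), ENNReal.ofReal (rexp (-b * ‖v‖ ^ 2)) =
      ENNReal.ofReal ((π / b) ^ (N / 2 : ℝ)) := by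
  have h := GaussianFourier.integral_rexp_neg_mul_sq_norm (V := EuclideanSpace ℝ (Fin N)) hb
  rw [finrank_euclideanSpace_fin] at h
  rw [← ofReal_integral_eq_lintegral_ofReal _ (ae_of_all _ fun v => (exp_pos _).le), h]
  exact .of_integral_ne_zero (by rw [h]; positivity)

lemma norm_sub_sq_div_add (x y z : EuclideanSpace ℝ (Fin N)) {σ τ : ℝ} (hσ : 0 < σ) (hτ : 0 < τ) :
    -‖x - y‖ ^ 2 / (4 * τ) + -‖y - z‖ ^ 2 / (4 * σ) =
      -‖x - z‖ ^ 2 / (4 * (τ + σ)) +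
        -((τ + σ) / (4 * τ * σ)) * ‖y - ((σ / (τ + σ)) • x + (τ / (τ + σ)) • z)‖ ^ 2 := by
  have h1 : y - ((σ / (τ + σ)) • x + (τ / (τ + σ)) • z) =
      (τ / (τ + σ)) • (y - z) - (σ / (τ + σ)) • (x - y) := by
    have : y = (τ / (τ + σ)) • y + (σ / (τ + σ)) • y := by
      rw [← add_smul, ← add_div, div_self (by positivity), one_smul]
    nth_rewrite 1 [this]
    module
  have h2 : x - z = (x - y) + (y - z) := by abel
  rw [h1, h2]
  generalize x - y = u
  generalize y - z = v
  rw [norm_sub_sq_real, norm_add_sq_real, norm_smul, norm_smul, inner_smul_left,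
    inner_smul_right, real_inner_comm, norm_of_nonneg (by positivity),
    norm_of_nonneg (by positivity)]
  simp only [conj_trivial]
  field_simp
  ring

lemma lintegral_heatKernel_mul (x z : EuclideanSpace ℝ (Fin N)) {σ τ : ℝ}
    (hσ : 0 < σ) (hτ : 0 < τ) :
    ∫⁻ y, ENNReal.ofReal (heatKernel N (x - y) τ * heatKernel N (y - z) σ) =
      ENNReal.ofReal (heatKernel N (x - z) (τ + σ)) := by
  set b := (τ + σ) / (4 * τ * σ) with hb
  have hb0 : 0 < b := by positivity
  set m := (σ / (τ + σ)) • x + (τ / (τ + σ)) • z with hm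
  set A := (4 * π * τ) ^ (-(N : ℝ) / 2) * (4 * π * σ) ^ (-(N : ℝ) / 2) *
    rexp (-‖x - z‖ ^ 2 / (4 * (τ + σ))) with hA
  have hA0 : 0 ≤ A := by positivity
  have key : ∀ y, ENNReal.ofReal (heatKernel N (x - y) τ * heatKernel N (y - z) σ) =
      ENNReal.ofReal A * ENNReal.ofReal (rexp (-b * ‖y - m‖ ^ 2)) := by
    intro y
    rw [← ENNReal.ofReal_mul hA0]
    congr 1
    unfold heatKernel
    rw [hA, mul_assoc _ (rexp _) (rexp _), ← Real.exp_add, hb, ← norm_sub_sq_div_add x y z hσ hτ,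
      Real.exp_add]
    ring
  simp_rw [key]
  rw [lintegral_const_mul _ (by fun_prop),
    lintegral_sub_right_eq_self (fun y => ENNReal.ofReal (rexp (-b * ‖y‖ ^ 2))) m,
    lintegral_rexp_neg_mul_sq_norm hb0, ← ENNReal.ofReal_mul hA0]
  congr 1
  unfold heatKernel
  have h3 : (4 * π * τ) ^ (-(N : ℝ) / 2) * (4 * π * σ) ^ (-(N : ℝ) / 2) * (π / b) ^ (N / 2 : ℝ) =
      (4 * π * (τ + σ)) ^ (-(N : ℝ) / 2) := by
    rw [show (N / 2 : ℝ) = -(-(N : ℝ) / 2) by ring, Real.rpow_neg (by positivity),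
      ← Real.inv_rpow (by positivity), ← Real.mul_rpow (by positivity) (by positivity),
      ← Real.mul_rpow (by positivity) (by positivity)]
    congr 1
    rw [hb]
    field_simp
  rw [hA, mul_right_comm, h3]

lemma lintegral_heatKernel (x : EuclideanSpace ℝ (Fin N)) {t : ℝ} (ht : 0 < t) :
    ∫⁻ y, ENNReal.ofReal (heatKernel N (x - y) t) = 1 := by
  have hA0 : 0 ≤ (4 * π * t) ^ (-(N : ℝ) / 2) := by positivity
  have key : ∀ y, ENNReal.ofReal (heatKernel N (x - y) t) =
      ENNReal.ofReal ((4 * π * t) ^ (-(N : ℝ) / 2)) *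
        ENNReal.ofReal (rexp (-(1 / (4 * t)) * ‖y - x‖ ^ 2)) := by
    intro y
    rw [← ENNReal.ofReal_mul hA0, heatKernel, norm_sub_rev]
    congr 3
    ring
  simp_rw [key]
  rw [lintegral_const_mul _ (by fun_prop),
    lintegral_sub_right_eq_self (fun y => ENNReal.ofReal (rexp (-(1 / (4 * t)) * ‖y‖ ^ 2))) x,
    lintegral_rexp_neg_mul_sq_norm (by positivity), ← ENNReal.ofReal_mul hA0,
    ← ENNReal.ofReal_one, neg_div, Real.rpow_neg (by positivity)]
  congr 1
  rw [show π / (1 / (4 * t)) = 4 * π * t by field_simp, inv_mul_cancel₀ (by positivity)]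

lemma heatKernel_le_mul_rexp (x : EuclideanSpace ℝ (Fin N)) {t : ℝ} (ht : 0 < t) :
    heatKernel N x t ≤ t ^ (-(N : ℝ) / 2) * rexp (-‖x‖ ^ 2 / (4 * t)) := by
  unfold heatKernel
  gcongr ?_ * _
  apply Real.rpow_le_rpow_of_nonpos ht _ (by rw [neg_div]; simp; positivity)
  nlinarith [pi_gt_three]

lemma heatKernel_le (x : EuclideanSpace ℝ (Fin N)) {t : ℝ} (ht : 0 < t) :
    heatKernel N x t ≤ t ^ (-(N : ℝ) / 2) := by
  refine (heatKernel_le_mul_rexp x ht).trans (mul_le_of_le_one_right (by positivity) ?_)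
  rw [Real.exp_le_one_iff, neg_div]
  exact neg_nonpos.2 (by positivity)

lemma exists_lintegral_heatKernel_mul_rpow_norm_le (hN : 1 ≤ N) {γ : ℝ} (hγ0 : 0 < γ)
    (hγN : γ < N) :
    ∃ C : ℝ, 0 < C ∧ ∀ (x : EuclideanSpace ℝ (Fin N)) (t : ℝ), 0 < t →
      ∫⁻ y, ENNReal.ofReal (heatKernel N (x - y) t * ‖y‖ ^ (-γ)) ≤
        ENNReal.ofReal (C * t ^ (-γ / 2)) := by
  have hmeas : Measurable fun y : EuclideanSpace ℝ (Fin N) => ‖y‖ ^ (-γ) := by fun_prop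
  have hint (r : ℝ) : IntegrableOn (fun y : EuclideanSpace ℝ (Fin N) => ‖y‖ ^ (-γ))
      (Metric.ball 0 r) :=
    integrableOn_ball_of_norm_le_rpow (C := 1) (α := γ) (by simpa using hN) (by simpa using hγN)
      (ae_of_all _ fun y => by rw [one_mul, norm_of_nonneg (by positivity)])
      hmeas.aestronglyMeasurable
  set C₀ := ∫ y in Metric.ball (0 : EuclideanSpace ℝ (Fin N)) 1, ‖y‖ ^ (-γ) with hC₀
  have hC₀0 : 0 ≤ C₀ := integral_nonneg fun y => by positivity
  refine ⟨C₀ + 1, by positivity, fun x t ht => ?_⟩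
  have hs : 0 < √t := sqrt_pos.2 ht
  have hscale : ∫ y in Metric.ball (0 : EuclideanSpace ℝ (Fin N)) √t, ‖y‖ ^ (-γ) =
      t ^ ((N : ℝ) / 2) * t ^ (-γ / 2) * C₀ := by
    have h := Measure.setIntegral_comp_smul_of_pos volume
      (fun y : EuclideanSpace ℝ (Fin N) => ‖y‖ ^ (-γ)) (Metric.ball 0 1) hs
    simp only [norm_smul, smul_unitBall hs.ne', finrank_euclideanSpace_fin, smul_eq_mul] at h
    rw [norm_of_nonneg hs.le] at h
    simp_rw [Real.mul_rpow hs.le (norm_nonneg _)] at h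
    rw [integral_const_mul, ← hC₀, eq_inv_mul_iff_mul_eq₀ (by positivity)] at h
    rw [← h, sqrt_eq_rpow, ← Real.rpow_natCast, ← Real.rpow_mul ht.le, ← Real.rpow_mul ht.le]
    ring_nf
  have hpt : ∀ y, ENNReal.ofReal (heatKernel N (x - y) t * ‖y‖ ^ (-γ)) ≤
      ENNReal.ofReal (t ^ (-(N : ℝ) / 2)) *
        (Metric.ball 0 √t).indicator (fun y => ENNReal.ofReal (‖y‖ ^ (-γ))) y +
      ENNReal.ofReal (t ^ (-γ / 2)) * ENNReal.ofReal (heatKernel N (x - y) t) := by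
    intro y
    by_cases hy : y ∈ Metric.ball 0 √t
    · refine le_add_right ?_
      rw [indicator_of_mem hy, ← ENNReal.ofReal_mul (by positivity)]
      gcongr
      exact heatKernel_le _ ht
    · refine le_add_left ?_
      rw [← ENNReal.ofReal_mul (by positivity), mul_comm]
      have := heatKernel_nonneg (x - y) ht
      gcongr
      rw [mem_ball_zero_iff, not_lt] at hy
      calc ‖y‖ ^ (-γ) ≤ √t ^ (-γ) := Real.rpow_le_rpow_of_nonpos hs hy (by linarith)
        _ = t ^ (-γ / 2) := by
          rw [sqrt_eq_rpow, ← Real.rpow_mul ht.le]; ring_nf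
  have hball : MeasurableSet (Metric.ball (0 : EuclideanSpace ℝ (Fin N)) √t) := measurableSet_ball
  calc _ ≤ _ := lintegral_mono hpt
    _ = ENNReal.ofReal (t ^ (-(N : ℝ) / 2)) *
          ENNReal.ofReal (t ^ ((N : ℝ) / 2) * t ^ (-γ / 2) * C₀) +
        ENNReal.ofReal (t ^ (-γ / 2)) * 1 := by
      rw [lintegral_add_right _ (by fun_prop), lintegral_const_mul _ (by fun_prop),
        lintegral_const_mul _ (by fun_prop), lintegral_heatKernel x ht,
        lintegral_indicator measurableSet_ball, ← hscale,
        ofReal_integral_eq_lintegral_ofReal (hint _) (ae_of_all _ fun y => by positivity)]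
    _ = _ := by
      rw [← ENNReal.ofReal_mul (by positivity), mul_one,
        ← ENNReal.ofReal_add (by positivity) (by positivity)]
      congr 1
      rw [neg_div, Real.rpow_neg ht.le]
      field_simp

lemma rexp_neg_le_rpow {k v : ℝ} (hk : 0 < k) (hv : 0 < v) : rexp (-v) ≤ (k / v) ^ k := by
  have h : (v / k) ^ k ≤ rexp v := by
    calc (v / k) ^ k ≤ rexp (v / k) ^ k := by
          gcongr; linarith [Real.add_one_le_exp (v / k)]
      _ = rexp v := by rw [← Real.exp_mul, div_mul_cancel₀ _ hk.ne']
  rw [Real.exp_neg, ← inv_div v k, Real.inv_rpow (by positivity)]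
  gcongr

lemma heatKernel_le_of_le_norm {k r T : ℝ} (hk : 0 < k) (hkN : (N : ℝ) / 2 ≤ k) (hr : 0 < r)
    {x : EuclideanSpace ℝ (Fin N)} (hx : r / 2 ≤ ‖x‖) {s : ℝ} (hs : s ∈ Ioo 0 T) :
    heatKernel N x s ≤ (16 * k) ^ k * T ^ (k - N / 2) * r ^ (-(2 * k)) := by
  have hs0 : 0 < s := hs.1
  have hv : 0 < r ^ 2 / (16 * s) := by positivity
  calc heatKernel N x s ≤ s ^ (-(N : ℝ) / 2) * rexp (-‖x‖ ^ 2 / (4 * s)) :=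
        heatKernel_le_mul_rexp x hs0
    _ ≤ s ^ (-(N : ℝ) / 2) * rexp (-(r ^ 2 / (16 * s))) := by
        have h : r ^ 2 / (16 * s) ≤ ‖x‖ ^ 2 / (4 * s) := by
          rw [show r ^ 2 / (16 * s) = (r / 2) ^ 2 / (4 * s) by field_simp; norm_num]
          gcongr
        rw [neg_div _ (‖x‖ ^ 2)]
        gcongr
    _ ≤ s ^ (-(N : ℝ) / 2) * (k / (r ^ 2 / (16 * s))) ^ k := by
        gcongr
        exact rexp_neg_le_rpow hk hv
    _ = (16 * k) ^ k * s ^ (k - N / 2) * r ^ (-(2 * k)) := by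
        rw [show k / (r ^ 2 / (16 * s)) = 16 * k * s * (r ^ (2 : ℝ))⁻¹ by
            rw [Real.rpow_two]; field_simp,
          Real.mul_rpow (by positivity) (by positivity),
          Real.mul_rpow (by positivity) (by positivity), Real.inv_rpow (by positivity),
          ← Real.rpow_mul hr.le, ← Real.rpow_neg hr.le, sub_eq_add_neg, Real.rpow_add hs0, neg_div]
        ring
    _ ≤ _ := by
        have hkN' : 0 ≤ k - N / 2 := by linarith
        gcongr
        exact hs.2.le

end HeatKernel

section Iteration

variable {X : Type*} [MeasurableSpace X]

/-- Picard iterates of `u = f + ∫ k u ^ p`, started from `0`. -/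
noncomputable def picardIterate (ν : Measure X) (k : X → X → ℝ≥0∞) (f : X → ℝ≥0∞) (p : ℝ) :
    ℕ → X → ℝ≥0∞
  | 0 => 0
  | n + 1 => fun q => f q + ∫⁻ r, k q r * picardIterate ν k f p n r ^ p ∂ν

variable {ν : Measure X} {k : X → X → ℝ≥0∞} {f : X → ℝ≥0∞} {p : ℝ}

lemma measurable_picardIterate [SFinite ν] (hk : Measurable (Function.uncurry k))
    (hf : Measurable f) (n : ℕ) : Measurable (picardIterate ν k f p n) := by
  induction n with
  | zero => exact measurable_const
  | succ n ih =>
    refine hf.add (Measurable.lintegral_prod_right' (f := fun z : X × X =>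
      k z.1 z.2 * picardIterate ν k f p n z.2 ^ p) ?_)
    exact hk.mul ((ih.comp measurable_snd).pow_const p)

lemma monotone_picardIterate (hp : 0 ≤ p) : Monotone (picardIterate ν k f p) := by
  refine monotone_nat_of_le_succ fun n => ?_
  induction n with
  | zero => exact fun q => zero_le
  | succ n ih =>
    intro q
    simp only [picardIterate]
    gcongr with r
    exact ih r

lemma picardIterate_le (hp : 0 ≤ p) {w : X → ℝ≥0∞}
    (hw : ∀ q, f q + ∫⁻ r, k q r * w r ^ p ∂ν ≤ w q) (n : ℕ) : picardIterate ν k f p n ≤ w := by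
  induction n with
  | zero => exact fun q => zero_le
  | succ n ih =>
    intro q
    refine le_trans ?_ (hw q)
    simp only [picardIterate]
    gcongr with r
    exact ih r

/-- A supersolution of `u = f + ∫ k u ^ p` dominates a measurable solution. -/
lemma exists_solution_le_supersolution [SFinite ν] (hk : Measurable (Function.uncurry k))
    (hf : Measurable f) (hp : 0 < p) {w : X → ℝ≥0∞}
    (hw : ∀ q, f q + ∫⁻ r, k q r * w r ^ p ∂ν ≤ w q) :
    ∃ u : X → ℝ≥0∞, Measurable u ∧ u ≤ w ∧ ∀ q, u q = f q + ∫⁻ r, k q r * u r ^ p ∂ν := by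
  have hmono := monotone_picardIterate (ν := ν) (k := k) (f := f) hp.le
  have hmeas := measurable_picardIterate (ν := ν) (p := p) hk hf
  refine ⟨fun q => ⨆ n, picardIterate ν k f p n q, .iSup hmeas,
    fun q => iSup_le fun n => picardIterate_le hp.le hw n q, fun q => ?_⟩
  have hkq : Measurable (k q) := hk.comp measurable_prodMk_left
  have hsup (r : X) : k q r * (⨆ n, picardIterate ν k f p n r) ^ p =
      ⨆ n, k q r * picardIterate ν k f p n r ^ p := by
    rw [← ENNReal.mul_iSup]
    exact congrArg _ ((ENNReal.orderIsoRpow p hp).map_iSup _)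
  simp_rw [hsup]
  rw [lintegral_iSup (f := fun n r => k q r * picardIterate ν k f p n r ^ p)
    (fun n => hkq.mul ((hmeas n).pow_const p)), ENNReal.add_iSup]
  · apply le_antisymm
    · refine iSup_le fun n => ?_
      exact (hmono (Nat.le_succ n) q).trans (le_iSup (fun n => picardIterate ν k f p (n + 1) q) n)
    · exact iSup_le fun n => le_iSup (fun n => picardIterate ν k f p n q) (n + 1)
  · exact fun m n hmn r => mul_le_mul_right (ENNReal.rpow_le_rpow (hmono hmn r) hp.le) _

end Iteration

section Duhamel

variable {N : ℕ} {γ p T : ℝ}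

/-- The kernel of the Duhamel term of the Hardy parabolic equation, on space-time. -/
noncomputable def duhamelKernel (N : ℕ) (γ : ℝ) (q r : EuclideanSpace ℝ (Fin N) × ℝ) : ℝ≥0∞ :=
  if r.2 ∈ Ioo 0 q.2 then
    ENNReal.ofReal (heatKernel N (q.1 - r.1) (q.2 - r.2) * ‖r.1‖ ^ (-γ)) else 0

lemma measurable_duhamelKernel : Measurable (Function.uncurry (duhamelKernel N γ)) := by
  unfold Function.uncurry duhamelKernel
  have h1 : MeasurableSet {a : (EuclideanSpace ℝ (Fin N) × ℝ) × EuclideanSpace ℝ (Fin N) × ℝ |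
      0 < a.2.2} := measurableSet_lt (by fun_prop) (by fun_prop)
  have h2 : MeasurableSet {a : (EuclideanSpace ℝ (Fin N) × ℝ) × EuclideanSpace ℝ (Fin N) × ℝ |
      a.2.2 < a.1.2} := measurableSet_lt (by fun_prop) (by fun_prop)
  exact Measurable.ite (h1.inter h2) (by fun_prop) measurable_const

lemma lintegral_duhamelKernel_mul {v : EuclideanSpace ℝ (Fin N) × ℝ → ℝ≥0∞} (hv : Measurable v)
    (x : EuclideanSpace ℝ (Fin N)) (t : ℝ) :
    ∫⁻ r, duhamelKernel N γ (x, t) r * v r = ∫⁻ s in Ioo 0 t, ∫⁻ y,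
      ENNReal.ofReal (heatKernel N (x - y) (t - s) * ‖y‖ ^ (-γ)) * v (y, s) := by
  have hk : Measurable (duhamelKernel N γ (x, t)) :=
    measurable_duhamelKernel.comp measurable_prodMk_left
  rw [Measure.volume_eq_prod, lintegral_prod_symm' (fun r => _ * v r) (hk.mul hv),
    ← lintegral_indicator measurableSet_Ioo]
  refine lintegral_congr fun s => ?_
  by_cases hs : s ∈ Ioo 0 t
  · simp only [duhamelKernel, if_pos hs, indicator_of_mem hs]
  · simp only [duhamelKernel, if_neg hs, indicator_of_notMem hs, zero_mul, lintegral_zero]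

lemma measurable_duhamel_integrand {v : EuclideanSpace ℝ (Fin N) × ℝ → ℝ≥0∞} (hv : Measurable v)
    (x : EuclideanSpace ℝ (Fin N)) (t : ℝ) :
    Measurable fun z : EuclideanSpace ℝ (Fin N) × ℝ =>
      ENNReal.ofReal (heatKernel N (x - z.1) (t - z.2) * ‖z.1‖ ^ (-γ)) * v z := by
  fun_prop

lemma integral_heatKernel_eq_toReal (μ : Measure (EuclideanSpace ℝ (Fin N)))
    (x : EuclideanSpace ℝ (Fin N)) {t : ℝ} (ht : 0 < t) :
    ∫ y, heatKernel N (x - y) t ∂μ = (∫⁻ y, ENNReal.ofReal (heatKernel N (x - y) t) ∂μ).toReal := by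
  refine integral_eq_lintegral_of_nonneg_ae (ae_of_all _ fun y => heatKernel_nonneg _ ht) ?_
  exact Measurable.aestronglyMeasurable (by fun_prop)

lemma integral_duhamel_eq_toReal {U : EuclideanSpace ℝ (Fin N) × ℝ → ℝ≥0∞} (hU : Measurable U)
    (hp : 0 ≤ p) (x : EuclideanSpace ℝ (Fin N)) {s t : ℝ} (hst : s < t)
    (hfin : ∀ y, U (y, s) ≠ ∞) :
    ∫ y, heatKernel N (x - y) (t - s) * ‖y‖ ^ (-γ) * (U (y, s)).toReal ^ p =
      (∫⁻ y, ENNReal.ofReal (heatKernel N (x - y) (t - s) * ‖y‖ ^ (-γ)) * U (y, s) ^ p).toReal := by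
  have hG (y) := heatKernel_nonneg (x - y) (sub_pos.2 hst)
  rw [integral_eq_lintegral_of_nonneg_ae]
  · congr 1
    refine lintegral_congr fun y => ?_
    have := hG y
    rw [ENNReal.ofReal_mul (by positivity), ENNReal.toReal_rpow,
      ENNReal.ofReal_toReal (ENNReal.rpow_ne_top_of_nonneg hp (hfin y))]
  · refine ae_of_all _ fun y => ?_
    have := hG y
    positivity
  · have hUs : Measurable fun y => U (y, s) := hU.comp measurable_prodMk_right
    exact Measurable.aestronglyMeasurable (by fun_prop)

/-- A finite supersolution on `(0, T)` yields a solution. -/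
lemma exists_isSolMeas_of_supersolution (hp : 0 < p) (μ : Measure (EuclideanSpace ℝ (Fin N)))
    [SFinite μ] {w : EuclideanSpace ℝ (Fin N) × ℝ → ℝ≥0∞} (hw : Measurable w)
    (hfin : ∀ x, ∀ t ∈ Ioo 0 T, w (x, t) ≠ ∞)
    (hsup : ∀ x, ∀ t ∈ Ioo 0 T, (∫⁻ y, ENNReal.ofReal (heatKernel N (x - y) t) ∂μ) +
      (∫⁻ s in Ioo 0 t, ∫⁻ y,
        ENNReal.ofReal (heatKernel N (x - y) (t - s) * ‖y‖ ^ (-γ)) * w (y, s) ^ p) ≤ w (x, t)) :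
    ∃ u, IsSolMeas N γ p T μ u := by
  set f : EuclideanSpace ℝ (Fin N) × ℝ → ℝ≥0∞ :=
    fun q => ∫⁻ y, ENNReal.ofReal (heatKernel N (q.1 - y) q.2) ∂μ with hf_def
  have hf : Measurable f := by
    refine Measurable.lintegral_prod_right'
      (f := fun a : (EuclideanSpace ℝ (Fin N) × ℝ) × EuclideanSpace ℝ (Fin N) =>
        ENNReal.ofReal (heatKernel N (a.1.1 - a.2) a.1.2)) (by fun_prop)
  set W : EuclideanSpace ℝ (Fin N) × ℝ → ℝ≥0∞ :=
    fun q => if q.2 ∈ Ioo 0 T then w q else ∞ with hW_def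
  have hW : Measurable W := Measurable.ite (measurable_snd measurableSet_Ioo) hw measurable_const
  have hWsup : ∀ q, f q + ∫⁻ r, duhamelKernel N γ q r * W r ^ p ≤ W q := by
    rintro ⟨x, t⟩
    by_cases ht : t ∈ Ioo 0 T
    · rw [lintegral_duhamelKernel_mul (hW.pow_const p)]
      simp only [hW_def, if_pos ht]
      refine le_trans (le_of_eq ?_) (hsup x t ht)
      congr 1
      refine setLIntegral_congr_fun measurableSet_Ioo fun s hs => ?_
      have : s ∈ Ioo 0 T := ⟨hs.1, hs.2.trans ht.2⟩
      simp only [if_pos this]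
    · simp only [hW_def, if_neg ht, le_top]
  obtain ⟨U, hU, hUW, hUeq⟩ :=
    exists_solution_le_supersolution measurable_duhamelKernel hf hp hWsup
  have hUfin : ∀ x, ∀ t ∈ Ioo 0 T, U (x, t) ≠ ∞ := fun x t ht => by
    refine ne_top_of_le_ne_top (hfin x t ht) ((hUW (x, t)).trans (le_of_eq ?_))
    simp only [hW_def, if_pos ht]
  refine ⟨fun x t => (U (x, t)).toReal, hU.ennreal_toReal, fun x t => ENNReal.toReal_nonneg,
    ae_of_all _ ?_⟩
  rintro ⟨x, t⟩ (ht : t ∈ Ioo 0 T)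
  have heq := hUeq (x, t)
  have hne := hUfin x t ht
  rw [lintegral_duhamelKernel_mul (hU.pow_const p)] at heq
  rw [heq, ENNReal.add_ne_top] at hne
  dsimp only
  rw [heq, ENNReal.toReal_add hne.1 hne.2, integral_heatKernel_eq_toReal μ x ht.1]
  congr 1
  have hmeas := (measurable_duhamel_integrand (γ := γ) (hU.pow_const p) x t).lintegral_prod_left'
    (μ := volume)
  rw [setIntegral_congr_fun measurableSet_Ioo fun s hs =>
    integral_duhamel_eq_toReal hU hp.le x hs.2 fun y => hUfin y s ⟨hs.1, hs.2.trans ht.2⟩,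
    integral_toReal hmeas.aemeasurable (ae_lt_top hmeas hne.2)]

end Duhamel

section Supersolution

lemma lintegral_Ioo_rpow_neg {b t : ℝ} (hb : b < 1) (ht : 0 < t) :
    ∫⁻ s in Ioo 0 t, ENNReal.ofReal (s ^ (-b)) = ENNReal.ofReal (t ^ (1 - b) / (1 - b)) := by
  rw [← ofReal_integral_eq_lintegral_ofReal]
  · rw [← integral_Ioc_eq_integral_Ioo, ← intervalIntegral.integral_of_le ht.le,
      integral_rpow (Or.inl (by linarith)), Real.zero_rpow (by linarith)]
    congr 1
    rw [sub_zero]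
    ring_nf
  · exact (intervalIntegral.integrableOn_Ioo_rpow_iff ht).2 (by linarith)
  · filter_upwards [ae_restrict_mem measurableSet_Ioo] with s hs
    exact Real.rpow_nonneg hs.1.le _

lemma lintegral_Ioo_sub_rpow_neg {b t : ℝ} (hb : b < 1) (ht : 0 < t) :
    ∫⁻ s in Ioo 0 t, ENNReal.ofReal ((t - s) ^ (-b)) = ENNReal.ofReal (t ^ (1 - b) / (1 - b)) := by
  rw [← lintegral_Ioo_rpow_neg hb ht, ← lintegral_indicator measurableSet_Ioo,
    ← lintegral_indicator measurableSet_Ioo, ← lintegral_sub_left_eq_self _ t]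
  refine lintegral_congr fun s => ?_
  by_cases hs : s ∈ Ioo 0 t
  · rw [indicator_of_mem hs, indicator_of_mem (show t - s ∈ Ioo 0 t from ⟨sub_pos.2 hs.2, sub_lt_self t hs.1⟩),
      sub_sub_cancel]
  · have hs' : t - s ∉ Ioo 0 t := fun h => hs ⟨by linarith [h.2], by linarith [h.1]⟩
    rw [indicator_of_notMem hs, indicator_of_notMem hs']

lemma add_rpow_le_two_rpow_mul {a b p : ℝ} (ha : 0 ≤ a) (hb : 0 ≤ b) (hp : 0 ≤ p) :
    (a + b) ^ p ≤ 2 ^ p * (a ^ p + b ^ p) := by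
  have hap := Real.rpow_nonneg ha p
  have hbp := Real.rpow_nonneg hb p
  rcases le_total a b with h | h
  · calc (a + b) ^ p ≤ (2 * b) ^ p := by gcongr; linarith
      _ = 2 ^ p * b ^ p := Real.mul_rpow zero_le_two hb
      _ ≤ _ := by gcongr; linarith
  · calc (a + b) ^ p ≤ (2 * a) ^ p := by gcongr; linarith
      _ = 2 ^ p * a ^ p := Real.mul_rpow zero_le_two ha
      _ ≤ _ := by gcongr; linarith

variable {N : ℕ} {γ p T : ℝ}

lemma heatKernel_rpow_le (hp : 1 ≤ p) (x : EuclideanSpace ℝ (Fin N)) {t : ℝ} (ht : 0 < t) :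
    heatKernel N x t ^ p ≤ t ^ (-(N * (p - 1) / 2)) * heatKernel N x t := by
  have hG := heatKernel_nonneg x ht
  calc heatKernel N x t ^ p = heatKernel N x t ^ (p - 1) * heatKernel N x t := by
        rw [← Real.rpow_add_one' hG (by linarith), sub_add_cancel]
    _ ≤ (t ^ (-(N : ℝ) / 2)) ^ (p - 1) * heatKernel N x t := by
        have hp' : 0 ≤ p - 1 := by linarith
        gcongr
        exact heatKernel_le x ht
    _ = _ := by
        rw [← Real.rpow_mul ht.le]
        ring_nf

lemma rpow_norm_mul_rpow_supersolution_le (hγ : 0 ≤ γ) (hp : 1 ≤ p) {K B : ℝ} (hK : 0 ≤ K)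
    (hB : 0 ≤ B) {y z : EuclideanSpace ℝ (Fin N)} (hz : z ≠ 0) {s : ℝ} (hs : 0 < s)
    (hKB : ‖y‖ < ‖z‖ / 2 → 2 * K * heatKernel N (y - z) s ≤ B) :
    ‖y‖ ^ (-γ) * (2 * K * heatKernel N (y - z) s + B) ^ p ≤
      (‖z‖ / 2) ^ (-γ) * 2 ^ p * (2 * K) ^ p * s ^ (-(N * (p - 1) / 2)) * heatKernel N (y - z) s +
        2 ^ p * B ^ p * ‖y‖ ^ (-γ) := by
  have hG := heatKernel_nonneg (y - z) hs
  have hz' : 0 < ‖z‖ := norm_pos_iff.2 hz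
  have hp0 : 0 ≤ p := by linarith
  rcases lt_or_ge ‖y‖ (‖z‖ / 2) with hy | hy
  · calc _ ≤ ‖y‖ ^ (-γ) * (2 * B) ^ p := by
          gcongr
          linarith [hKB hy]
      _ = 2 ^ p * B ^ p * ‖y‖ ^ (-γ) := by rw [Real.mul_rpow zero_le_two hB]; ring
      _ ≤ _ := le_add_of_nonneg_left (by positivity)
  · calc _ ≤ ‖y‖ ^ (-γ) * (2 ^ p * ((2 * K * heatKernel N (y - z) s) ^ p + B ^ p)) := by
          gcongr
          exact add_rpow_le_two_rpow_mul (by positivity) hB hp0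
      _ = ‖y‖ ^ (-γ) * (2 ^ p * (2 * K) ^ p * heatKernel N (y - z) s ^ p) +
            2 ^ p * B ^ p * ‖y‖ ^ (-γ) := by
          rw [Real.mul_rpow (by positivity) hG]; ring
      _ ≤ (‖z‖ / 2) ^ (-γ) * (2 ^ p * (2 * K) ^ p *
            (s ^ (-(N * (p - 1) / 2)) * heatKernel N (y - z) s)) +
            2 ^ p * B ^ p * ‖y‖ ^ (-γ) := by
          have h1 : ‖y‖ ^ (-γ) ≤ (‖z‖ / 2) ^ (-γ) :=
            Real.rpow_le_rpow_of_nonpos (by positivity) hy (by linarith)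
          have h2 := heatKernel_rpow_le hp (y - z) hs
          gcongr
      _ = _ := by ring

lemma lintegral_heatKernel_initial_le {K C₀ : ℝ} (hK : 0 ≤ K) {φ : EuclideanSpace ℝ (Fin N) → ℝ}
    (hφ : Measurable φ) (hC₀ : 0 ≤ C₀) (hφC : ∀ᵐ x, φ x ≤ C₀) (x z : EuclideanSpace ℝ (Fin N))
    {t : ℝ} (ht : 0 < t) :
    ∫⁻ y, ENNReal.ofReal (heatKernel N (x - y) t) ∂(ENNReal.ofReal K • Measure.dirac z +
        volume.withDensity (fun y => ENNReal.ofReal (φ y))) ≤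
      ENNReal.ofReal (K * heatKernel N (x - z) t + C₀) := by
  have hG := heatKernel_nonneg (x - z) ht
  rw [lintegral_add_measure, lintegral_smul_measure, lintegral_dirac' _ (by fun_prop),
    lintegral_withDensity_eq_lintegral_mul _ (by fun_prop) (by fun_prop),
    ENNReal.ofReal_add (by positivity) hC₀, ENNReal.ofReal_mul hK, smul_eq_mul]
  gcongr
  calc _ ≤ ∫⁻ y, ENNReal.ofReal C₀ * ENNReal.ofReal (heatKernel N (x - y) t) := by
        refine lintegral_mono_ae ?_
        filter_upwards [hφC] with y hy
        exact mul_le_mul_left (ENNReal.ofReal_le_ofReal hy) _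
    _ = _ := by
        rw [lintegral_const_mul _ (by fun_prop), lintegral_heatKernel x ht, mul_one]

/-- The function `2 K G(x - z, t) + B` is a supersolution for the initial data `K δ_z + φ`. -/
lemma exists_isSolMeas_dirac_add (hγ0 : 0 ≤ γ) (hγ2 : γ < 2) (hp : 1 < p)
    (hpN : N * (p - 1) / 2 < 1) {C : ℝ} (hC : 0 ≤ C)
    (hCle : ∀ (x : EuclideanSpace ℝ (Fin N)) (t : ℝ), 0 < t →
      ∫⁻ y, ENNReal.ofReal (heatKernel N (x - y) t * ‖y‖ ^ (-γ)) ≤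
        ENNReal.ofReal (C * t ^ (-γ / 2)))
    {K B C₀ : ℝ} (hK : 0 ≤ K) (hB : 0 ≤ B) (hC₀ : 0 ≤ C₀) {z : EuclideanSpace ℝ (Fin N)}
    (hz : z ≠ 0) {φ : EuclideanSpace ℝ (Fin N) → ℝ} (hφ : Measurable φ)
    (hφC : ∀ᵐ x, φ x ≤ C₀)
    (hKB : ∀ y, ∀ s ∈ Ioo 0 T, ‖y‖ < ‖z‖ / 2 → 2 * K * heatKernel N (y - z) s ≤ B)
    (hKK : (‖z‖ / 2) ^ (-γ) * 2 ^ p * (2 * K) ^ p *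
      (T ^ (1 - N * (p - 1) / 2) / (1 - N * (p - 1) / 2)) ≤ K)
    (hBB : 2 ^ p * B ^ p * C * (T ^ (1 - γ / 2) / (1 - γ / 2)) + C₀ ≤ B) :
    ∃ u, IsSolMeas N γ p T (ENNReal.ofReal K • Measure.dirac z +
      volume.withDensity (fun y => ENNReal.ofReal (φ y))) u := by
  have hp0 : 0 < p := by linarith
  set a := N * (p - 1) / 2 with ha
  set A := (‖z‖ / 2) ^ (-γ) * 2 ^ p * (2 * K) ^ p with hA
  set D := 2 ^ p * B ^ p with hD
  have hA0 : 0 ≤ A := by positivity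
  have hD0 : 0 ≤ D := by positivity
  refine exists_isSolMeas_of_supersolution hp0 _
    (w := fun q => ENNReal.ofReal (2 * K * heatKernel N (q.1 - z) q.2 + B)) (by fun_prop)
    (fun x t _ => ENNReal.ofReal_ne_top) fun x t ht => ?_
  have hG := heatKernel_nonneg (x - z) ht.1
  have hsource : ∀ s ∈ Ioo 0 t,
      ∫⁻ y, ENNReal.ofReal (heatKernel N (x - y) (t - s) * ‖y‖ ^ (-γ)) *
        ENNReal.ofReal (2 * K * heatKernel N (y - z) s + B) ^ p ≤
      ENNReal.ofReal (A * heatKernel N (x - z) t) * ENNReal.ofReal (s ^ (-a)) +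
        ENNReal.ofReal (D * C) * ENNReal.ofReal ((t - s) ^ (-(γ / 2))) := by
    intro s hs
    have hts : 0 < t - s := sub_pos.2 hs.2
    have hs0 : 0 < s := hs.1
    calc _ ≤ ∫⁻ y, (ENNReal.ofReal (A * s ^ (-a)) *
            ENNReal.ofReal (heatKernel N (x - y) (t - s) * heatKernel N (y - z) s) +
          ENNReal.ofReal D * ENNReal.ofReal (heatKernel N (x - y) (t - s) * ‖y‖ ^ (-γ))) := by
          refine lintegral_mono fun y => ?_
          have h1 := heatKernel_nonneg (x - y) hts
          have h2 := heatKernel_nonneg (y - z) hs.1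
          have h3 := rpow_norm_mul_rpow_supersolution_le hγ0 hp.le hK hB hz hs.1
            (hKB y s ⟨hs.1, hs.2.trans ht.2⟩)
          rw [ENNReal.ofReal_rpow_of_nonneg (by positivity) hp0.le,
            ← ENNReal.ofReal_mul (by positivity), ← ENNReal.ofReal_mul (by positivity),
            ← ENNReal.ofReal_mul (by positivity),
            ← ENNReal.ofReal_add (by positivity) (by positivity)]
          refine ENNReal.ofReal_le_ofReal ?_
          rw [mul_assoc (heatKernel N (x - y) (t - s))]
          refine (mul_le_mul_of_nonneg_left h3 h1).trans (le_of_eq ?_)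
          ring
      _ = ENNReal.ofReal (A * s ^ (-a)) * ENNReal.ofReal (heatKernel N (x - z) t) +
          ENNReal.ofReal D *
            ∫⁻ y, ENNReal.ofReal (heatKernel N (x - y) (t - s) * ‖y‖ ^ (-γ)) := by
          rw [lintegral_add_left (by fun_prop), lintegral_const_mul _ (by fun_prop),
            lintegral_const_mul _ (by fun_prop), lintegral_heatKernel_mul x z hs.1 hts,
            sub_add_cancel]
      _ ≤ _ := by
          gcongr ?_ + ?_
          · rw [← ENNReal.ofReal_mul (by positivity), ← ENNReal.ofReal_mul (by positivity)]
            refine ENNReal.ofReal_le_ofReal (le_of_eq (by ring))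
          · refine (mul_le_mul_right (hCle x (t - s) hts) _).trans (le_of_eq ?_)
            rw [← ENNReal.ofReal_mul hD0, ← ENNReal.ofReal_mul (by positivity), neg_div, mul_assoc D]
  have hnonlin : ∫⁻ s in Ioo 0 t, ∫⁻ y,
      ENNReal.ofReal (heatKernel N (x - y) (t - s) * ‖y‖ ^ (-γ)) *
        ENNReal.ofReal (2 * K * heatKernel N (y - z) s + B) ^ p ≤
      ENNReal.ofReal (A * heatKernel N (x - z) t * (t ^ (1 - a) / (1 - a)) +
        D * C * (t ^ (1 - γ / 2) / (1 - γ / 2))) := by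
    refine (setLIntegral_mono (by fun_prop) hsource).trans (le_of_eq ?_)
    rw [lintegral_add_left (by fun_prop), lintegral_const_mul _ (by fun_prop),
      lintegral_const_mul _ (by fun_prop), lintegral_Ioo_rpow_neg hpN ht.1,
      lintegral_Ioo_sub_rpow_neg (by linarith) ht.1, ← ENNReal.ofReal_mul (by positivity),
      ← ENNReal.ofReal_mul (by positivity), ← ENNReal.ofReal_add]
    · have := Real.rpow_nonneg ht.1.le (1 - a)
      have : 0 < 1 - a := by linarith
      positivity
    · have := Real.rpow_nonneg ht.1.le (1 - γ / 2)
      have : 0 < 1 - γ / 2 := by linarith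
      positivity
  refine (add_le_add (lintegral_heatKernel_initial_le hK hφ hC₀ hφC x z ht.1) hnonlin).trans ?_
  have h1a : 0 < 1 - a := by linarith
  have h1γ : 0 < 1 - γ / 2 := by linarith
  have ht0 := ht.1
  rw [← ENNReal.ofReal_add (by positivity) (by positivity)]
  refine ENNReal.ofReal_le_ofReal ?_
  have hta : A * (t ^ (1 - a) / (1 - a)) ≤ A * (T ^ (1 - a) / (1 - a)) := by
    gcongr; exact ht.2.le
  have htγ : D * C * (t ^ (1 - γ / 2) / (1 - γ / 2)) ≤ D * C * (T ^ (1 - γ / 2) / (1 - γ / 2)) := by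
    gcongr; exact ht.2.le
  have := mul_le_mul_of_nonneg_right (hta.trans hKK) hG
  linarith

end Supersolution

theorem statement3 (N : ℕ) (hN : 1 ≤ N) (γ p : ℝ)
    (hγ0 : 0 < γ) (hγ : γ < min 2 (N : ℝ))
    (hp1 : 1 < p) (hp2 : p < 1 + 2 / (N : ℝ)) :
    ∃ cstar Cstar : ℝ, 0 < cstar ∧ 0 < Cstar ∧
      ∀ (T : ℝ), 0 < T →
      ∀ (z : EuclideanSpace ℝ (Fin N)), z ≠ 0 →
      ∀ (φ : EuclideanSpace ℝ (Fin N) → ℝ) (c C₀ : ℝ),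
        Measurable φ → (∀ x, 0 ≤ φ x) →
        0 < c →
        c ≤ cstar * T ^ (-(N : ℝ) * ((1 + 2 / (N : ℝ)) - p) / (2 * (p - 1))) *
              (1 + T ^ (1 - γ / 2)) ^ (-1 / (p - 1)) →
        0 ≤ C₀ → C₀ ≤ Cstar * T ^ (-(2 - γ) / (2 * (p - 1))) →
        (∀ᵐ x : EuclideanSpace ℝ (Fin N), φ x ≤ C₀) →
        ∃ u, IsSolMeas N γ p T
          (ENNReal.ofReal (c * (‖z‖ ^ (2 / (p - 1)) * (1 + ‖z‖) ^ (-(2 - γ) / (p - 1)))) •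
              Measure.dirac z +
            volume.withDensity (fun y => ENNReal.ofReal (φ y))) u := by
  set k : ℝ := 1 / (p - 1) with hk
  have hp' : 0 < p - 1 := by linarith
  have hk0 : 0 < k := by positivity
  have hkp : k * (p - 1) = 1 := by rw [hk]; field_simp
  have hN0 : (0 : ℝ) < N := by exact_mod_cast hN
  have hγ2 : γ < 2 := hγ.trans_le (min_le_left _ _)
  have hγN : γ < N := hγ.trans_le (min_le_right _ _)
  have hpN : N * (p - 1) / 2 < 1 := by
    have h : (p - 1) * N < 2 := (lt_div_iff₀ hN0).1 (by linarith)
    linarith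
  have hkN : (N : ℝ) / 2 ≤ k := by
    rw [hk, le_div_iff₀ hp']
    linarith
  obtain ⟨C, hC, hCle⟩ := exists_lintegral_heatKernel_mul_rpow_norm_le hN hγ0 hγN
  have h1γ : 0 < 1 - γ / 2 := by linarith
  have h1a : 0 < 1 - N * (p - 1) / 2 := by linarith
  set Cs := ((1 - γ / 2) / (2 ^ (p + 1) * C)) ^ k / 2 with hCs
  have hCs0 : 0 < Cs := by positivity
  set cs := min (Cs / (16 * k) ^ k)
    (((1 - N * (p - 1) / 2) / (2 ^ p * 2 ^ p * 2 ^ γ)) ^ k) with hcs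
  have hcs0 : 0 < cs := by positivity
  refine ⟨cs, Cs, hcs0, hCs0, ?_⟩
  intro T hT z hz φ c C₀ hφ hφ0 hc hcle hC₀ hC₀le hφC
  have hz' : 0 < ‖z‖ := norm_pos_iff.2 hz
  have he1 : -(N : ℝ) * ((1 + 2 / (N : ℝ)) - p) / (2 * (p - 1)) = N / 2 - k := by
    rw [hk]; field_simp; ring
  have he2 : -1 / (p - 1) = -k := by rw [hk]; ring
  have he3 : -(2 - γ) / (2 * (p - 1)) = -((1 - γ / 2) * k) := by rw [hk]; field_simp
  have he4 : 2 / (p - 1) = 2 * k := by rw [hk]; ring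
  have he5 : -(2 - γ) / (p - 1) = -((2 - γ) * k) := by rw [hk]; ring
  rw [he1, he2] at hcle
  rw [he3] at hC₀le
  rw [he4, he5]
  set ψ := ‖z‖ ^ (2 * k) * (1 + ‖z‖) ^ (-((2 - γ) * k)) with hψ
  have h2γk : 0 ≤ (2 - γ) * k := mul_nonneg (by linarith) hk0.le
  have hψ1 : ψ ≤ ‖z‖ ^ (2 * k) := by
    refine mul_le_of_le_one_right (by positivity) ?_
    exact Real.rpow_le_one_of_one_le_of_nonpos (by linarith) (by linarith)
  have hψ2 : ψ ≤ ‖z‖ ^ (γ * k) := by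
    calc ψ ≤ ‖z‖ ^ (2 * k) * ‖z‖ ^ (-((2 - γ) * k)) := by
          rw [hψ]
          gcongr ?_ * ?_
          exact Real.rpow_le_rpow_of_nonpos hz' (by linarith) (by linarith)
      _ = ‖z‖ ^ (γ * k) := by
          rw [← Real.rpow_add hz']; ring_nf
  have hψ0 : 0 < ψ := by positivity
  have hTγ : 0 < T ^ (1 - γ / 2) := by positivity
  have hc1 : c ≤ cs * T ^ (N / 2 - k) := by
    refine hcle.trans (mul_le_of_le_one_right (by positivity) ?_)
    exact Real.rpow_le_one_of_one_le_of_nonpos (by linarith) (by linarith)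
  have hc2 : c ≤ cs * T ^ (N / 2 - k) * T ^ (-((1 - γ / 2) * k)) := by
    refine hcle.trans ?_
    gcongr
    calc _ ≤ (T ^ (1 - γ / 2)) ^ (-k) :=
          Real.rpow_le_rpow_of_nonpos hTγ (by linarith) (by linarith)
      _ = _ := by rw [← Real.rpow_mul hT.le]; ring_nf
  set B := 2 * Cs * T ^ (-((1 - γ / 2) * k)) with hB
  have hB0 : 0 < B := by positivity
  refine exists_isSolMeas_dirac_add hγ0.le hγ2 hp1 hpN hC.le hCle (B := B) (C₀ := C₀)
    (by positivity) hB0.le hC₀ hz hφ hφC ?_ ?_ ?_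
  · intro y s hs hy
    have hyz : ‖z‖ / 2 ≤ ‖y - z‖ := by
      have := norm_sub_norm_le z y
      rw [norm_sub_rev] at this
      linarith
    have hcs1 : cs * (16 * k) ^ k ≤ Cs := (le_div_iff₀ (by positivity)).1 (min_le_left _ _)
    calc 2 * (c * ψ) * heatKernel N (y - z) s
        ≤ 2 * (cs * T ^ (N / 2 - k) * T ^ (-((1 - γ / 2) * k)) * ‖z‖ ^ (2 * k)) *
          ((16 * k) ^ k * T ^ (k - N / 2) * ‖z‖ ^ (-(2 * k))) := by
          have := heatKernel_nonneg (y - z) hs.1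
          have := heatKernel_le_of_le_norm hk0 hkN hz' hyz hs
          gcongr
      _ = 2 * (cs * (16 * k) ^ k) * T ^ (-((1 - γ / 2) * k)) *
          (T ^ (N / 2 - k) * T ^ (k - N / 2)) * (‖z‖ ^ (2 * k) * ‖z‖ ^ (-(2 * k))) := by ring
      _ = 2 * (cs * (16 * k) ^ k) * T ^ (-((1 - γ / 2) * k)) := by
          rw [← Real.rpow_add hT, ← Real.rpow_add hz']
          simp
      _ ≤ B := by rw [hB]; gcongr
  · have hKp : (c * ψ) ^ (p - 1) ≤ (1 - N * (p - 1) / 2) / (2 ^ p * 2 ^ p * 2 ^ γ) *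
        T ^ (-(1 - N * (p - 1) / 2)) * ‖z‖ ^ γ := by
      calc (c * ψ) ^ (p - 1) ≤ (((1 - N * (p - 1) / 2) / (2 ^ p * 2 ^ p * 2 ^ γ)) ^ k *
            T ^ (N / 2 - k) * ‖z‖ ^ (γ * k)) ^ (p - 1) := by
            have : c ≤ ((1 - N * (p - 1) / 2) / (2 ^ p * 2 ^ p * 2 ^ γ)) ^ k * T ^ (N / 2 - k) :=
              hc1.trans (by gcongr; exact min_le_right _ _)
            gcongr
        _ = _ := by
            rw [Real.mul_rpow (by positivity) (by positivity),
              Real.mul_rpow (by positivity) (by positivity), ← Real.rpow_mul (by positivity),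
              ← Real.rpow_mul hT.le, ← Real.rpow_mul hz'.le, hkp, Real.rpow_one, mul_assoc γ, hkp,
              mul_one, show (N / 2 - k) * (p - 1) = -(1 - N * (p - 1) / 2) by
                rw [sub_mul, hkp]; ring]
    have hKpos : 0 < c * ψ := by positivity
    rw [Real.mul_rpow zero_le_two hKpos.le, show (c * ψ) ^ p = (c * ψ) ^ (p - 1) * (c * ψ) by
      rw [← Real.rpow_add_one hKpos.ne', sub_add_cancel], Real.div_rpow hz'.le zero_le_two,
      Real.rpow_neg hz'.le, Real.rpow_neg zero_le_two]
    have hT1 := Real.rpow_neg hT.le (1 - N * (p - 1) / 2)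
    rw [hT1] at hKp
    calc _ = ((‖z‖ ^ γ)⁻¹ / (2 ^ γ)⁻¹ * 2 ^ p * 2 ^ p *
          (T ^ (1 - N * (p - 1) / 2) / (1 - N * (p - 1) / 2)) * (c * ψ) ^ (p - 1)) * (c * ψ) := by
          ring
      _ ≤ ((‖z‖ ^ γ)⁻¹ / (2 ^ γ)⁻¹ * 2 ^ p * 2 ^ p *
          (T ^ (1 - N * (p - 1) / 2) / (1 - N * (p - 1) / 2)) *
          ((1 - N * (p - 1) / 2) / (2 ^ p * 2 ^ p * 2 ^ γ) *
            (T ^ (1 - N * (p - 1) / 2))⁻¹ * ‖z‖ ^ γ)) * (c * ψ) := by gcongr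
      _ = c * ψ := by
          generalize 1 - N * (p - 1) / 2 = a at *
          field_simp
  · have hBp : B ^ (p - 1) = (1 - γ / 2) / (2 ^ (p + 1) * C) * (T ^ (1 - γ / 2))⁻¹ := by
      rw [hB, hCs, mul_div_cancel₀ _ two_ne_zero, Real.mul_rpow (by positivity) (by positivity),
        ← Real.rpow_mul (by positivity), ← Real.rpow_mul hT.le, hkp, Real.rpow_one, neg_mul,
        mul_assoc (1 - γ / 2), hkp, mul_one, Real.rpow_neg hT.le]
    have hCB : C₀ ≤ B / 2 := hC₀le.trans (le_of_eq (by rw [hB]; ring))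
    have : 2 ^ p * B ^ p * C * (T ^ (1 - γ / 2) / (1 - γ / 2)) = B / 2 := by
      rw [show B ^ p = B ^ (p - 1) * B by
        rw [← Real.rpow_add_one hB0.ne', sub_add_cancel], hBp, Real.rpow_add_one two_ne_zero]
      generalize 1 - γ / 2 = b at h1γ ⊢
      field_simp
    linarith
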